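/- Let A be a C*-algebra, and let B be a closed *-subalgebra of A and I ⊆ A a C*-subalgebra such that BI ⊆ I and IB ⊆ I. If I and B are C*-algebras, then I + B is a C*-subalgebra of A. Consequently, if F ⊆ P is a finite ∨-closed subset of the positive cone of a quasi-lattice ordered group with maximum p_F, and for each s ∈ F, i_{s⁻¹p_F}(K(X_s)) ⊆ L(X_{p_F}) are the images of the compacts under the inclusion maps of a compactly aligned product system X, then B_F = Σ_{s∈F} i_{s⁻¹p_F}(K(X_s)) is a C*-subalgebra of L(X_{p_F}). -/

import Mathlib

variable {G : Type*} [Group G]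

/-- The left-invariant relation `g ≤ h ↔ g⁻¹h ∈ P` on `G`. -/
def qle (P : Set G) (g h : G) : Prop := g⁻¹ * h ∈ P

/-- `m` is the least upper bound of `g` and `h` for the order `qle P`. -/
def qlub (P : Set G) (g h m : G) : Prop :=
  qle P g m ∧ qle P h m ∧ ∀ u, qle P g u → qle P h u → qle P m u

/-- `(G, P)` is a quasi-lattice ordered group: `P` is a subsemigroup with
`P ∩ P⁻¹ = {e}`, and any two elements with a common upper bound have a least one. -/
def IsQLO (P : Set G) : Prop :=
  (∀ a ∈ P, ∀ b ∈ P, a * b ∈ P) ∧ (1 : G) ∈ P ∧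
  (∀ a ∈ P, a⁻¹ ∈ P → a = 1) ∧
  (∀ g h : G, (∃ u, qle P g u ∧ qle P h u) → ∃ m, qlub P g h m)

/-- `ω` is directed: any two elements have a least upper bound lying in `ω`. -/
def QDirected (P : Set G) (ω : Set G) : Prop :=
  ∀ g ∈ ω, ∀ h ∈ ω, ∃ m ∈ ω, qlub P g h m

/-- `ω` is hereditary: downward closed for `qle P`. -/
def QHereditary (P : Set G) (ω : Set G) : Prop :=
  ∀ g h : G, h ∈ ω → qle P g h → g ∈ ω

open Pointwise in
/-- Soft-threshold approximation in the self-adjoint case. -/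
theorem dix_sa {A : Type*} [NonUnitalCStarAlgebra A]
    (B I : NonUnitalStarSubalgebra ℂ A)
    (hB : IsClosed (B : Set A)) (hI : IsClosed (I : Set A))
    (hBI : ∀ b ∈ B, ∀ x ∈ I, b * x ∈ I ∧ x * b ∈ I)
    (b y : A) (hb : b ∈ B) (hy : y ∈ I) (hbs : IsSelfAdjoint b) (hys : IsSelfAdjoint y) :
    ∃ d ∈ B, d ∈ I ∧ ‖b - d‖ ≤ ‖b + y‖ := by
  let S : NonUnitalStarSubalgebra ℂ (A × A) :=
    { carrier := {u | u.1 - u.2 ∈ I ∧ u.2 ∈ B}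
      add_mem' := by
        rintro u v ⟨h1, h2⟩ ⟨h3, h4⟩
        refine ⟨?_, add_mem h2 h4⟩
        have := add_mem h1 h3
        convert this using 1
        simp only [Prod.fst_add, Prod.snd_add]; abel
      zero_mem' := by
        refine ⟨?_, B.zero_mem⟩
        simpa using I.zero_mem
      mul_mem' := by
        rintro u v ⟨h1, h2⟩ ⟨h3, h4⟩
        refine ⟨?_, mul_mem h2 h4⟩
        have := add_mem (add_mem (mul_mem h1 h3) (hBI _ h4 _ h1).2) (hBI _ h2 _ h3).1
        convert this using 1
        simp only [Prod.fst_mul, Prod.snd_mul]; noncomm_ring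
      smul_mem' := by
        rintro c u ⟨h1, h2⟩
        refine ⟨?_, SMulMemClass.smul_mem c h2⟩
        have := SMulMemClass.smul_mem c h1
        convert this using 1
        simp only [Prod.smul_fst, Prod.smul_snd, smul_sub]
      star_mem' := by
        rintro u ⟨h1, h2⟩
        refine ⟨?_, star_mem h2⟩
        have := star_mem h1
        convert this using 1
        simp }
  have hS : IsClosed (S : Set (A × A)) := by
    have h1 : IsClosed {u : A × A | u.1 - u.2 ∈ (I : Set A)} :=
      hI.preimage (continuous_fst.sub continuous_snd)
    have h2 : IsClosed {u : A × A | u.2 ∈ (B : Set A)} := hB.preimage continuous_snd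
    exact h1.inter h2
  set δ := ‖b + y‖ with hδ
  have hδ0 : 0 ≤ δ := norm_nonneg _
  let g : ℝ → ℝ := fun t => max (-δ) (min t δ)
  let f : ℝ → ℝ := fun t => t - g t
  have hg : Continuous g := by fun_prop
  have hf : Continuous f := by fun_prop
  have hg0 : g 0 = 0 := by simp [g, hδ0]
  have hf0 : f 0 = 0 := by simp [f, hg0]
  have hbys : IsSelfAdjoint (b + y) := hbs.add hys
  have hmem : ((b + y, b) : A × A) ∈ S := by
    refine ⟨?_, hb⟩
    simpa using hy
  have hsa : IsSelfAdjoint ((b + y, b) : A × A) := by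
    rw [IsSelfAdjoint, Prod.star_def]
    exact Prod.ext hbys hbs
  have key : cfcₙ f ((b + y, b) : A × A) ∈ S := cfcₙ_mem (𝕜' := ℂ) (hs := hS) f hmem
  rw [cfcₙ_map_prod (S := ℂ) f (b + y) b hf.continuousOn hsa hbys hbs] at key
  have hz : cfcₙ f (b + y) = 0 := by
    rw [← cfcₙ_const_zero ℝ (b + y)]
    apply cfcₙ_congr
    intro t ht
    have h1 := norm_apply_le_norm_cfcₙ (id : ℝ → ℝ) (b + y) ht
    rw [cfcₙ_id ℝ (b + y), ← hδ, id, Real.norm_eq_abs, abs_le] at h1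
    simp [f, g, h1.1, h1.2]
  refine ⟨cfcₙ f b, key.2, ?_, ?_⟩
  · have := neg_mem (show cfcₙ f (b + y) - cfcₙ f b ∈ I from key.1)
    simpa [hz] using this
  · have : b - cfcₙ f b = cfcₙ g b := by
      have h := cfcₙ_sub (fun t : ℝ => t) f b (by fun_prop) rfl hf.continuousOn hf0
      rw [cfcₙ_id' ℝ b] at h
      rw [← h]
      congr 1
      ext t
      simp [f]
    rw [this]
    apply norm_cfcₙ_le
    intro t _
    rw [Real.norm_eq_abs, abs_le]
    exact ⟨le_max_left _ _, max_le (by linarith) (min_le_right _ _)⟩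

open Pointwise in
theorem dix_gen {A : Type*} [NonUnitalCStarAlgebra A]
    (B I : NonUnitalStarSubalgebra ℂ A)
    (hB : IsClosed (B : Set A)) (hI : IsClosed (I : Set A))
    (hBI : ∀ b ∈ B, ∀ x ∈ I, b * x ∈ I ∧ x * b ∈ I)
    (b y : A) (hb : b ∈ B) (hy : y ∈ I) :
    ∃ d ∈ B, d ∈ I ∧ ‖b - d‖ ≤ 2 * ‖b + y‖ := by
  have hre : ∀ (S : NonUnitalStarSubalgebra ℂ A), ∀ x ∈ S, (realPart x : A) ∈ S := by
    intro S x hx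
    rw [realPart_apply_coe, ← Complex.coe_smul]
    exact SMulMemClass.smul_mem _ (add_mem hx (star_mem hx))
  have him : ∀ (S : NonUnitalStarSubalgebra ℂ A), ∀ x ∈ S, (imaginaryPart x : A) ∈ S := by
    intro S x hx
    rw [imaginaryPart_apply_coe, ← Complex.coe_smul (2⁻¹ : ℝ)]
    exact SMulMemClass.smul_mem _ (SMulMemClass.smul_mem _ (sub_mem hx (star_mem hx)))
  obtain ⟨d, hdB, hdI, hd⟩ := dix_sa B I hB hI hBI _ _ (hre B b hb) (hre I y hy)
    (realPart b).2 (realPart y).2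
  obtain ⟨e, heB, heI, he⟩ := dix_sa B I hB hI hBI _ _ (him B b hb) (him I y hy)
    (imaginaryPart b).2 (imaginaryPart y).2
  refine ⟨d + Complex.I • e, add_mem hdB (SMulMemClass.smul_mem _ heB),
    add_mem hdI (SMulMemClass.smul_mem _ heI), ?_⟩
  have h1 : b - (d + Complex.I • e)
      = ((realPart b : A) - d) + Complex.I • ((imaginaryPart b : A) - e) := by
    conv_lhs => rw [← realPart_add_I_smul_imaginaryPart b]
    rw [smul_sub]; abel
  have h2 : ‖(realPart b : A) + (realPart y : A)‖ ≤ ‖b + y‖ := by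
    have := realPart.norm_le (b + y)
    simpa using this
  have h3 : ‖(imaginaryPart b : A) + (imaginaryPart y : A)‖ ≤ ‖b + y‖ := by
    have := imaginaryPart.norm_le (b + y)
    simpa using this
  rw [h1]
  refine (norm_add_le _ _).trans ?_
  rw [norm_smul, Complex.norm_I]
  linarith

open Pointwise in
theorem dixmier {A : Type*} [NonUnitalCStarAlgebra A]
    (B I : NonUnitalStarSubalgebra ℂ A)
    (hB : IsClosed (B : Set A)) (hI : IsClosed (I : Set A))
    (hBI : ∀ b ∈ B, ∀ x ∈ I, b * x ∈ I ∧ x * b ∈ I) :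
    ∃ C : NonUnitalStarSubalgebra ℂ A, IsClosed (C : Set A) ∧
        (C : Set A) = (I : Set A) + (B : Set A) := by
  let C : NonUnitalStarSubalgebra ℂ A :=
    { carrier := (I : Set A) + (B : Set A)
      add_mem' := by
        rintro _ _ ⟨x, hx, b, hb, rfl⟩ ⟨y, hy, c, hc, rfl⟩
        exact ⟨x + y, add_mem hx hy, b + c, add_mem hb hc, by simp only; abel⟩
      zero_mem' := ⟨0, I.zero_mem, 0, B.zero_mem, by simp⟩
      mul_mem' := by
        rintro _ _ ⟨x, hx, b, hb, rfl⟩ ⟨y, hy, c, hc, rfl⟩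
        exact ⟨x * y + x * c + b * y,
          add_mem (add_mem (mul_mem hx hy) (hBI _ hc _ hx).2) (hBI _ hb _ hy).1,
          b * c, mul_mem hb hc, by simp only; noncomm_ring⟩
      smul_mem' := by
        rintro k _ ⟨x, hx, b, hb, rfl⟩
        exact ⟨k • x, SMulMemClass.smul_mem k hx, k • b, SMulMemClass.smul_mem k hb, by simp⟩
      star_mem' := by
        rintro _ ⟨x, hx, b, hb, rfl⟩
        exact ⟨star x, star_mem hx, star b, star_mem hb, by simp⟩ }
  refine ⟨C, ?_, rfl⟩
  let I' := I.toSubmodule.toAddSubgroup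
  let B' := B.toSubmodule.toAddSubgroup
  have : CompleteSpace I' := hI.isComplete.completeSpace_coe
  have : CompleteSpace B' := hB.isComplete.completeSpace_coe
  let φ : NormedAddGroupHom (I' × B') A :=
    AddMonoidHom.mkNormedAddGroupHom (I'.subtype.coprod B'.subtype) 2 (by
      rintro ⟨x, b⟩
      refine (norm_add_le _ _).trans ?_
      have h1 : ‖(x : A)‖ ≤ ‖(x, b)‖ := norm_fst_le (x, b)
      have h2 : ‖(b : A)‖ ≤ ‖(x, b)‖ := norm_snd_le (x, b)
      simp only [AddMonoidHom.coe_comp, Function.comp, AddMonoidHom.coe_fst, AddMonoidHom.coe_snd,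
        AddSubgroup.subtype_apply]
      linarith)
  have hφ : ∀ x b, φ (x, b) = (x : A) + (b : A) := fun x b => rfl
  let K : AddSubgroup A := C.toSubmodule.toAddSubgroup
  have hsurj : φ.SurjectiveOnWith K 3 := by
    rintro _ ⟨x, hx, b, hb, rfl⟩
    obtain ⟨d, hdB, hdI, hd⟩ := dix_gen B I hB hI hBI b x hb hx
    refine ⟨(⟨x + d, add_mem hx hdI⟩, ⟨b - d, sub_mem hb hdB⟩), ?_, ?_⟩
    · rw [hφ]; simp only; abel
    · simp only
      rw [add_comm b x] at hd
      have h0 := norm_nonneg (x + b)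
      refine max_le ?_ ?_
      · change ‖x + d‖ ≤ _
        have : x + d = (x + b) - (b - d) := by abel
        rw [this]
        refine (norm_sub_le _ _).trans ?_
        linarith
      · change ‖b - d‖ ≤ _
        linarith
  have hcl := controlled_closure_of_complete (by norm_num) one_pos hsurj
  refine isClosed_of_closure_subset ?_
  intro z hz
  obtain ⟨⟨x, b⟩, hxb, -⟩ := hcl z hz
  exact ⟨x, x.2, b, b.2, hxb⟩

open Pointwise in
theorem sum_closed (P : Set G) (hQ : IsQLO P)
    {L : Type*} [NonUnitalCStarAlgebra L]
    (K : G → NonUnitalStarSubalgebra ℂ L)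
    (hKclosed : ∀ s, IsClosed (K s : Set L)) (n : ℕ) :
    ∀ F : Finset G, F.card = n →
    (∀ p ∈ F, ∀ q ∈ F, ∃ m ∈ F, qlub P p q m) →
    (∀ s ∈ F, ∀ t ∈ F, ∀ m, qlub P s t m → ∀ x ∈ K s, ∀ y ∈ K t, x * y ∈ K m) →
      ∃ D : NonUnitalStarSubalgebra ℂ L, IsClosed (D : Set L) ∧
        (D : Set L) = ∑ s ∈ F, (K s : Set L) := by
  classical
  obtain ⟨hmul, hone, hanti, -⟩ := hQ
  induction n with
  | zero =>
    intro F hF _ _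
    rw [Finset.card_eq_zero] at hF
    subst hF
    refine ⟨⊥, ?_, ?_⟩
    · rw [NonUnitalStarAlgebra.coe_bot]; exact isClosed_singleton
    · rw [NonUnitalStarAlgebra.coe_bot]; rfl
  | succ n ih =>
    intro F hF hvee halign
    have hle_anti : ∀ a b : G, qle P a b → qle P b a → a = b := by
      intro a b h1 h2
      have := hanti _ h1 (by simpa [qle] using h2)
      exact (inv_mul_eq_one.mp this)
    let po : PartialOrder G :=
      { le := qle P
        le_refl := fun a => by simpa [qle] using hone
        le_trans := fun a b c h1 h2 => by
          have := hmul _ h1 _ h2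
          simpa [qle, mul_assoc] using this
        le_antisymm := hle_anti }
    have hne : F.Nonempty := Finset.card_pos.mp (by omega)
    obtain ⟨q, hq⟩ := F.exists_minimal hne
    have hqF : q ∈ F := hq.1
    have hqm : ∀ s ∈ F, qle P s q → s = q := fun s hs h => hle_anti _ _ h (hq.2 hs h)
    have hvee' : ∀ p ∈ F, ∀ r ∈ F.erase q, ∀ m ∈ F, (qlub P p r m ∨ qlub P r p m) →
        m ∈ F.erase q := by
      intro p hp r hr m hm hlub
      refine Finset.mem_erase.mpr ⟨?_, hm⟩
      rintro rfl
      have hrq : qle P r m := hlub.elim (fun h => h.2.1) (fun h => h.1)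
      exact (Finset.mem_erase.mp hr).1 (hqm r (Finset.mem_erase.mp hr).2 hrq)
    obtain ⟨D, hDc, hD⟩ := ih (F.erase q) (by rw [Finset.card_erase_of_mem hqF, hF]; rfl)
      (fun p hp r hr => by
        obtain ⟨m, hm, hl⟩ := hvee p (Finset.mem_of_mem_erase hp) r (Finset.mem_of_mem_erase hr)
        exact ⟨m, hvee' p (Finset.mem_of_mem_erase hp) r hr m hm (Or.inl hl), hl⟩)
      (fun s hs t ht => halign s (Finset.mem_of_mem_erase hs) t (Finset.mem_of_mem_erase ht))
    have hKD : ∀ s ∈ F.erase q, ∀ x ∈ K s, x ∈ D := by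
      intro s hs x hx
      rw [← SetLike.mem_coe, hD, Set.mem_finsetSum]
      refine ⟨fun t => if t = s then x else 0, ?_, ?_⟩
      · intro t _
        by_cases h : t = s
        · subst h; simpa using hx
        · simp [h]
      · rw [Finset.sum_ite_eq' (F.erase q) s (fun _ => x), if_pos hs]
    obtain ⟨C, hCc, hC⟩ := dixmier (K q) D (hKclosed q) hDc (by
      intro b hb x hx
      rw [← SetLike.mem_coe, hD, Set.mem_finsetSum] at hx
      obtain ⟨g, hg, rfl⟩ := hx
      rw [Finset.mul_sum, Finset.sum_mul]
      constructor
      · refine sum_mem fun s hs => ?_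
        have hsF := Finset.mem_of_mem_erase hs
        obtain ⟨m, hm, hl⟩ := hvee q hqF s hsF
        exact hKD m (hvee' q hqF s hs m hm (Or.inl hl)) _
          (halign q hqF s hsF m hl b hb _ (hg hs))
      · refine sum_mem fun s hs => ?_
        have hsF := Finset.mem_of_mem_erase hs
        obtain ⟨m, hm, hl⟩ := hvee s hsF q hqF
        exact hKD m (hvee' q hqF s hs m hm (Or.inr hl)) _
          (halign s hsF q hqF m hl _ (hg hs) b hb))
    refine ⟨C, hCc, ?_⟩
    rw [hC, hD, Finset.sum_erase_add _ _ hqF]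

open Pointwise in
/-- (Dixmier) if `B` is a closed *-subalgebra and `I` a C*-subalgebra of a
C*-algebra `A` with `BI ⊆ I` and `IB ⊆ I`, then `I + B` is a C*-subalgebra of `A`.
Consequently, for a finite `∨`-closed `F ⊆ P` with maximum `p_F`, with
`K s` modelling the image `i_{s⁻¹p_F}(K(X_s)) ⊆ L(X_{p_F})` of the compacts of a
compactly aligned product system (so that `K s · K t ⊆ K (s ∨ t)`),
the sum `B_F = Σ_{s ∈ F} i_{s⁻¹p_F}(K(X_s))` is a C*-subalgebra of `L(X_{p_F})`. -/
theorem stmt19 {A : Type*} [NonUnitalCStarAlgebra A]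
    (B I : NonUnitalStarSubalgebra ℂ A)
    (hB : IsClosed (B : Set A)) (hI : IsClosed (I : Set A))
    (hBI : ∀ b ∈ B, ∀ x ∈ I, b * x ∈ I ∧ x * b ∈ I)
    (P : Set G) (hQ : IsQLO P)
    (F : Finset G) (hFP : ∀ p ∈ F, p ∈ P) (hne : F.Nonempty)
    (hvee : ∀ p ∈ F, ∀ q ∈ F, ∃ m ∈ F, qlub P p q m)
    (pF : G) (hpF : pF ∈ F) (hmaxF : ∀ p ∈ F, qle P p pF)
    {L : Type*} [NonUnitalCStarAlgebra L]
    (K : G → NonUnitalStarSubalgebra ℂ L)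
    (hKclosed : ∀ s, IsClosed (K s : Set L))
    (halign : ∀ s ∈ F, ∀ t ∈ F, ∀ m, qlub P s t m →
      ∀ x ∈ K s, ∀ y ∈ K t, x * y ∈ K m) :
    (∃ C : NonUnitalStarSubalgebra ℂ A, IsClosed (C : Set A) ∧
        (C : Set A) = (I : Set A) + (B : Set A)) ∧
      ∃ D : NonUnitalStarSubalgebra ℂ L, IsClosed (D : Set L) ∧
        (D : Set L) = ∑ s ∈ F, (K s : Set L) := by
  exact ⟨dixmier B I hB hI hBI,
    sum_closed P hQ K hKclosed F.card F rfl hvee halign⟩
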